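/- Given a right linear ω-grammar G = (N, T, P, S₀, 𝓕), there can be constructed a right linear ω-grammar G' = (N', T, P', S₀, 𝓗) all of whose productions are of the form A → aB or A → a with a ∈ T ∪ {ε}, such that L_{σ,ρ,π}(G) = L_{σ,ρ,π}(G') for every σ ∈ {ran, inf}, ρ ∈ {⊓, ⊆, =}, and π ∈ {l, nl}. -/

import Mathlib

namespace OmegaFormal

/-- σ component of an acceptance mode: `ran` (occurs at least once)
or `inf` (occurs infinitely often). -/
inductive AccSigma | ran | inf
deriving DecidableEq

/-- ρ component of an acceptance mode: `cap` (nonempty intersection, ⊓),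
`sub` (⊆) or `eq` (=). -/
inductive AccRho | cap | sub | eq
deriving DecidableEq

/-- derivation mode: leftmost (`l`) or normal (`nl`). -/
inductive DerivMode | l | nl
deriving DecidableEq

/-- `sigmaSet σ f` is ran(f) resp. inf(f). -/
def sigmaSet {Q : Type _} : AccSigma → (ℕ → Q) → Set Q
  | .ran, f => Set.range f
  | .inf, f => {q | ∀ n : ℕ, ∃ m : ℕ, n ≤ m ∧ f m = q}

/-- the binary relation denoted by ρ. -/
def rhoRel {Q : Type _} : AccRho → Set Q → Set Q → Prop
  | .cap, A, B => (A ∩ B).Nonempty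
  | .sub, A, B => A ⊆ B
  | .eq,  A, B => A = B

/-- f is (σ,ρ)-accepting w.r.t. the set 𝓕 of designated sets. -/
def IsAccepting {Q : Type _} (σ : AccSigma) (ρ : AccRho) (𝓕 : Set (Set Q)) (f : ℕ → Q) : Prop :=
  ∃ F ∈ 𝓕, rhoRel ρ (sigmaSet σ f) F

/-- the finite word `l` coincides with the prefix of the ω-word `u`. -/
def MatchesPrefix {T : Type _} (l : List T) (u : ℕ → T) : Prop :=
  ∀ (k : ℕ) (h : k < l.length), l.get ⟨k, h⟩ = u k

/-- the maximal terminal prefix of a sentential form. -/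
def termPrefix {N T : Type _} : List (N ⊕ T) → List T
  | [] => []
  | (Sum.inl _) :: _ => []
  | (Sum.inr a) :: l => a :: termPrefix l

/-- A phrase structure ω-grammar `G = (N, T, P, S, 𝓕)`:
`N` nonterminals, `T` terminals, `P` named productions `p : lhs p → rhs p`
with `lhs p ∈ N⁺`, `rhs p ∈ (N ∪ T)*`, start symbol, and
production repetition sets `acc ⊆ 2^P`. -/
structure OmegaPSG (T : Type) where
  N : Type
  [fintypeN : Fintype N]
  P : Type
  [fintypeP : Fintype P]
  lhs : P → List N
  lhs_ne : ∀ p : P, lhs p ≠ []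
  rhs : P → List (N ⊕ T)
  start : N
  acc : Set (Set P)

namespace OmegaPSG

variable {T : Type} (G : OmegaPSG T)

/-- one (normal) rewriting step using production p. -/
def Step (p : G.P) (x y : List (G.N ⊕ T)) : Prop :=
  ∃ u v : List (G.N ⊕ T),
    x = u ++ (G.lhs p).map Sum.inl ++ v ∧ y = u ++ G.rhs p ++ v

/-- one leftmost rewriting step: the rewritten occurrence starts at the
leftmost nonterminal, i.e. everything to its left is terminal. -/
def LStep (p : G.P) (x y : List (G.N ⊕ T)) : Prop :=
  ∃ u v : List (G.N ⊕ T), (∀ s ∈ u, ∃ a : T, s = Sum.inr a) ∧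
    x = u ++ (G.lhs p).map Sum.inl ++ v ∧ y = u ++ G.rhs p ++ v

def StepOf : DerivMode → G.P → List (G.N ⊕ T) → List (G.N ⊕ T) → Prop
  | .l => G.LStep
  | .nl => G.Step

/-- `L_{σ,ρ,π}(G)`: ω-words admitting an infinite π-derivation from S whose
growing terminal prefixes spell the word and whose production sequence is
(σ,ρ)-accepting w.r.t. `G.acc`. -/
def Lang (σ : AccSigma) (ρ : AccRho) (π : DerivMode) : Set (ℕ → T) :=
  {u | ∃ (s : ℕ → List (G.N ⊕ T)) (d : ℕ → G.P),
    s 0 = [Sum.inl G.start] ∧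
    (∀ i : ℕ, G.StepOf π (d i) (s i) (s (i + 1))) ∧
    (∀ n : ℕ, ∃ i : ℕ, n ≤ (termPrefix (s i)).length) ∧
    (∀ i : ℕ, MatchesPrefix (termPrefix (s i)) u) ∧
    IsAccepting σ ρ G.acc d}

/-- context-free: every left-hand side is a single nonterminal. -/
def IsCFG : Prop := ∀ p : G.P, (G.lhs p).length = 1

/-- context-sensitive (monotonic): `|β| ≥ |α|` for every production. -/
def IsCSG : Prop := ∀ p : G.P, (G.lhs p).length ≤ (G.rhs p).length

/-- right linear: productions of the form `A → uB` or `A → u`, `u ∈ T*`. -/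
def IsRLG : Prop :=
  ∀ p : G.P, (G.lhs p).length = 1 ∧
    ∃ (w : List T) (B : Option G.N),
      G.rhs p = w.map Sum.inr ++ B.toList.map Sum.inl

/-- `G` is a grammar with `$`-boundary (PSG version): with `$` = `dollar`,
`S` = `S'`, every production has one of the forms
(1) α → β, α,β ∈ N⁺ (N = nonterminals other than `$`, `S`),
(2) S → $α, α ∈ N⁺, (3) $A → a$, (4) A → ε. -/
def HasDollarBoundary (dollar S' : G.N) : Prop :=
  dollar ≠ S' ∧ G.start = S' ∧
  ∀ p : G.P,
    ((dollar ∉ G.lhs p ∧ S' ∉ G.lhs p) ∧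
      ∃ β : List G.N, β ≠ [] ∧ dollar ∉ β ∧ S' ∉ β ∧ G.rhs p = β.map Sum.inl) ∨
    (G.lhs p = [S'] ∧ ∃ α : List G.N, α ≠ [] ∧ dollar ∉ α ∧ S' ∉ α ∧
      G.rhs p = Sum.inl dollar :: α.map Sum.inl) ∨
    (∃ A : G.N, A ≠ dollar ∧ A ≠ S' ∧ G.lhs p = [dollar, A] ∧
      ∃ a : T, G.rhs p = [Sum.inr a, Sum.inl dollar]) ∨
    (∃ A : G.N, A ≠ dollar ∧ A ≠ S' ∧ G.lhs p = [A] ∧ G.rhs p = [])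

/-- `G` is a grammar with `$`-boundary (CSG version): forms (1)-(3) only,
with `|α| ≤ |β|` in form (1). -/
def HasDollarBoundaryCSG (dollar S' : G.N) : Prop :=
  dollar ≠ S' ∧ G.start = S' ∧
  ∀ p : G.P,
    ((dollar ∉ G.lhs p ∧ S' ∉ G.lhs p) ∧
      ∃ β : List G.N, β ≠ [] ∧ dollar ∉ β ∧ S' ∉ β ∧ (G.lhs p).length ≤ β.length ∧
        G.rhs p = β.map Sum.inl) ∨
    (G.lhs p = [S'] ∧ ∃ α : List G.N, α ≠ [] ∧ dollar ∉ α ∧ S' ∉ α ∧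
      G.rhs p = Sum.inl dollar :: α.map Sum.inl) ∨
    (∃ A : G.N, A ≠ dollar ∧ A ≠ S' ∧ G.lhs p = [dollar, A] ∧
      ∃ a : T, G.rhs p = [Sum.inr a, Sum.inl dollar])

end OmegaPSG

/-- `𝓛_{σ,ρ,π}(X)` for the family `X` of ω-grammars over `T` satisfying `C`. -/
def GLang (T : Type) (C : OmegaPSG T → Prop) (σ : AccSigma) (ρ : AccRho) (π : DerivMode) :
    Set (Set (ℕ → T)) :=
  {L | ∃ G : OmegaPSG T, C G ∧ L = G.Lang σ ρ π}

/-- number of non-ε labels among `b 0, …, b (i-1)`. -/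
def someCount {A : Type _} (b : ℕ → Option A) (i : ℕ) : ℕ :=
  ((Finset.range i).filter fun j => (b j).isSome = true).card

/-- the (ε-allowing) label sequence `b` concatenates to the ω-word `u`. -/
def Spells {A : Type _} (b : ℕ → Option A) (u : ℕ → A) : Prop :=
  (∀ n : ℕ, ∃ i : ℕ, n ≤ someCount b i) ∧
  ∀ i : ℕ, ∀ a : A, b i = some a → a = u (someCount b i)

/-- A finite state ω-automaton `(Q, Σ, δ, q₀, 𝓕)`. -/
structure OmegaFSA (Sig : Type) where
  Q : Type
  [fintypeQ : Fintype Q]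
  init : Q
  trans : Q → Option Sig → Q → Prop
  acc : Set (Set Q)

/-- `L_{σ,ρ}(A)` for a finite state ω-automaton. -/
def OmegaFSA.Lang {Sig : Type} (A : OmegaFSA Sig) (σ : AccSigma) (ρ : AccRho) :
    Set (ℕ → Sig) :=
  {u | ∃ (r : ℕ → A.Q) (b : ℕ → Option Sig),
    r 0 = A.init ∧ (∀ i : ℕ, A.trans (r i) (b i) (r (i + 1))) ∧
    Spells b u ∧ IsAccepting σ ρ A.acc r}

/-- `𝓛_{σ,ρ}(ω-FSA)`. -/
def FSALang (Sig : Type) (σ : AccSigma) (ρ : AccRho) : Set (Set (ℕ → Sig)) :=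
  {L | ∃ A : OmegaFSA Sig, L = A.Lang σ ρ}

/-- A pushdown ω-automaton `(Q, Σ, Γ, δ, q₀, Z₀, 𝓕)`. -/
structure OmegaPDA (Sig : Type) where
  Q : Type
  [fintypeQ : Fintype Q]
  Γ : Type
  [fintypeΓ : Fintype Γ]
  init : Q
  Z0 : Γ
  trans : Q → Option Sig → Γ → Q → List Γ → Prop
  acc : Set (Set Q)

/-- `L_{σ,ρ}(D)` for a pushdown ω-automaton. -/
def OmegaPDA.Lang {Sig : Type} (D : OmegaPDA Sig) (σ : AccSigma) (ρ : AccRho) :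
    Set (ℕ → Sig) :=
  {u | ∃ (q : ℕ → D.Q) (st : ℕ → List D.Γ) (b : ℕ → Option Sig),
    q 0 = D.init ∧ st 0 = [D.Z0] ∧
    (∀ i : ℕ, ∃ (Z : D.Γ) (γ rest : List D.Γ),
      st i = Z :: rest ∧ D.trans (q i) (b i) Z (q (i + 1)) γ ∧ st (i + 1) = γ ++ rest) ∧
    Spells b u ∧ IsAccepting σ ρ D.acc q}

/-- `𝓛_{σ,ρ}(ω-PDA)`. -/
def PDALang (Sig : Type) (σ : AccSigma) (ρ : AccRho) : Set (Set (ℕ → Sig)) :=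
  {L | ∃ D : OmegaPDA Sig, L = D.Lang σ ρ}

/-- tape head moves. -/
inductive Move | L | R | S
deriving DecidableEq

def moveHead : Move → ℕ → ℕ
  | .L, n => n - 1
  | .R, n => n + 1
  | .S, n => n

/-- A single-tape Turing ω-machine `(Q, Σ, Γ, δ, q₀, 𝓕)` (Σ ⊆ Γ via `embed`). -/
structure OmegaTM (Sig : Type) where
  Q : Type
  [fintypeQ : Fintype Q]
  Γ : Type
  [fintypeΓ : Fintype Γ]
  embed : Sig → Γ
  embed_inj : Function.Injective embed
  init : Q
  trans : Q → Γ → Q → Γ → Move → Prop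
  acc : Set (Set Q)

/-- `L_{σ,ρ}(M)`: ω-words admitting a complete non-oscillating run whose state
sequence is (σ,ρ)-accepting. -/
def OmegaTM.Lang {Sig : Type} (M : OmegaTM Sig) (σ : AccSigma) (ρ : AccRho) :
    Set (ℕ → Sig) :=
  {u | ∃ (q : ℕ → M.Q) (tape : ℕ → ℕ → M.Γ) (pos : ℕ → ℕ),
    q 0 = M.init ∧ (∀ n : ℕ, tape 0 n = M.embed (u n)) ∧ pos 0 = 0 ∧
    (∀ i : ℕ, ∃ (g : M.Γ) (m : Move),
      M.trans (q i) (tape i (pos i)) (q (i + 1)) g m ∧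
      tape (i + 1) = Function.update (tape i) (pos i) g ∧
      pos (i + 1) = moveHead m (pos i)) ∧
    (∀ n : ℕ, ∃ i : ℕ, n ≤ pos i) ∧
    (∀ n : ℕ, ∃ i0 : ℕ, ∀ i : ℕ, i0 ≤ i → pos i ≠ n) ∧
    IsAccepting σ ρ M.acc q}

/-- `𝓛_{σ,ρ}(ω-TM)`. -/
def TMLang (Sig : Type) (σ : AccSigma) (ρ : AccRho) : Set (Set (ℕ → Sig)) :=
  {L | ∃ M : OmegaTM Sig, L = M.Lang σ ρ}

/-- An m-tape Turing ω-machine. -/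
structure OmegaMTM (m : ℕ) (Sig : Type) where
  Q : Type
  [fintypeQ : Fintype Q]
  Γ : Type
  [fintypeΓ : Fintype Γ]
  embed : Sig → Γ
  embed_inj : Function.Injective embed
  blank : Γ
  init : Q
  trans : Q → (Fin m → Γ) → Q → (Fin m → Γ) → (Fin m → Move) → Prop
  acc : Set (Set Q)

/-- `L_{σ,ρ}(M)` for an m-tape Turing ω-machine (`hm : 0 < m`; the input is on
the first tape, the other tapes are initially blank; the run must be complete
and non-oscillating on the first tape). -/
def OmegaMTM.Lang {m : ℕ} {Sig : Type} (M : OmegaMTM m Sig) (hm : 0 < m)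
    (σ : AccSigma) (ρ : AccRho) : Set (ℕ → Sig) :=
  {u | ∃ (q : ℕ → M.Q) (tape : ℕ → Fin m → ℕ → M.Γ) (pos : ℕ → Fin m → ℕ),
    q 0 = M.init ∧
    (∀ n : ℕ, tape 0 ⟨0, hm⟩ n = M.embed (u n)) ∧
    (∀ j : Fin m, j ≠ ⟨0, hm⟩ → ∀ n : ℕ, tape 0 j n = M.blank) ∧
    (∀ j : Fin m, pos 0 j = 0) ∧
    (∀ i : ℕ, ∃ (g : Fin m → M.Γ) (mv : Fin m → Move),
      M.trans (q i) (fun j => tape i j (pos i j)) (q (i + 1)) g mv ∧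
      (∀ j : Fin m, tape (i + 1) j = Function.update (tape i j) (pos i j) (g j)) ∧
      (∀ j : Fin m, pos (i + 1) j = moveHead (mv j) (pos i j))) ∧
    (∀ n : ℕ, ∃ i : ℕ, n ≤ pos i ⟨0, hm⟩) ∧
    (∀ n : ℕ, ∃ i0 : ℕ, ∀ i : ℕ, i0 ≤ i → pos i ⟨0, hm⟩ ≠ n) ∧
    IsAccepting σ ρ M.acc q}

/-- `𝓛_{σ,ρ}(m-ω-TM)`. -/
def MTMLang (Sig : Type) (m : ℕ) (hm : 0 < m) (σ : AccSigma) (ρ : AccRho) :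
    Set (Set (ℕ → Sig)) :=
  {L | ∃ M : OmegaMTM m Sig, L = M.Lang hm σ ρ}

/-- the ω-language `{aⁿbⁿ | n ≥ 1}^ω` over the alphabet `Bool`
(`false` = a, `true` = b). -/
def abLang : Set (ℕ → Bool) :=
  {u | ∃ n : ℕ → ℕ, (∀ i : ℕ, 1 ≤ n i) ∧
    ∀ i k : ℕ, k < 2 * n i →
      u ((∑ j ∈ Finset.range i, 2 * n j) + k) = decide (n i ≤ k)}

end OmegaFormal
open OmegaFormal

namespace OmegaFormal

section Runs

variable {N P T : Type}

/-- The terminal word emitted by the first `n` productions of `d`, where `w p` is the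
terminal part of the right-hand side of `p`. -/
def emitted (w : P → List T) (d : ℕ → P) : ℕ → List T
  | 0 => []
  | n + 1 => emitted w d n ++ w (d n)

theorem emitted_prefix (w : P → List T) (d : ℕ → P) {m n : ℕ} (h : m ≤ n) :
    emitted w d m <+: emitted w d n := by
  induction n, h using Nat.le_induction with
  | base => exact List.prefix_refl _
  | succ n _ ih => exact ih.trans (List.prefix_append _ _)

theorem MatchesPrefix.of_prefix {l l' : List T} {u : ℕ → T} (hu : MatchesPrefix l' u)
    (h : l <+: l') : MatchesPrefix l u := by
  intro k hk
  rw [← hu k (hk.trans_le h.length_le)]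
  simpa using h.getElem hk

/-- `d` is a chain of right linear productions `A p → (w p)(B p)` starting at `S` and
spelling `u`. -/
structure IsRun (A : P → N) (w : P → List T) (B : P → Option N) (S : N) (d : ℕ → P)
    (u : ℕ → T) : Prop where
  start : A (d 0) = S
  next : ∀ i, B (d i) = some (A (d (i + 1)))
  unbounded : ∀ n, ∃ i, n ≤ (emitted w d i).length
  spells : ∀ i, MatchesPrefix (emitted w d i) u

end Runs

theorem termPrefix_map_append {N T : Type} (w : List T) (o : Option N) :
    termPrefix (w.map Sum.inr ++ o.toList.map Sum.inl : List (N ⊕ T)) = w := by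
  induction w with
  | nil => cases o <;> simp [termPrefix]
  | cons a w ih => simpa [termPrefix] using ih

theorem eq_of_append_inl_eq {N T : Type} {a : N} {o : Option N} {v : List (N ⊕ T)}
    {w : List T} {u : List (N ⊕ T)}
    (h : w.map Sum.inr ++ o.toList.map Sum.inl = u ++ [Sum.inl a] ++ v) :
    u = w.map Sum.inr ∧ v = [] ∧ o = some a := by
  induction w generalizing u with
  | nil => cases o <;> cases u <;> simp_all
  | cons b w ih =>
    cases u with
    | nil => simp at h
    | cons x u =>
      simp only [List.map_cons, List.cons_append, List.cons.injEq] at h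
      obtain ⟨rfl, h⟩ := h
      obtain ⟨rfl, h'⟩ := ih h
      exact ⟨rfl, h'⟩

namespace OmegaPSG

variable {T : Type} (G : OmegaPSG T)

theorem stepOf_iff (π : DerivMode) {p : G.P} {a : G.N} (hp : G.lhs p = [a]) (w : List T)
    (o : Option G.N) (y : List (G.N ⊕ T)) :
    G.StepOf π p (w.map Sum.inr ++ o.toList.map Sum.inl) y ↔
      o = some a ∧ y = w.map Sum.inr ++ G.rhs p := by
  constructor
  · intro h
    have hs : G.Step p (w.map Sum.inr ++ o.toList.map Sum.inl) y := by
      cases π with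
      | l => obtain ⟨u, v, -, h⟩ := h; exact ⟨u, v, h⟩
      | nl => exact h
    obtain ⟨u, v, hx, hy⟩ := hs
    rw [hp] at hx
    obtain ⟨rfl, rfl, ho⟩ := eq_of_append_inl_eq hx
    exact ⟨ho, by simpa using hy⟩
  · rintro ⟨rfl, rfl⟩
    have hl : G.LStep p (w.map Sum.inr ++ (some a).toList.map Sum.inl)
        (w.map Sum.inr ++ G.rhs p) :=
      ⟨w.map Sum.inr, [], by simp, by simp [hp], by simp⟩
    cases π with
    | l => exact hl
    | nl => obtain ⟨u, v, -, h⟩ := hl; exact ⟨u, v, h⟩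

/-- The languages of a right linear ω-grammar in terms of chains of productions; in
particular both derivation modes agree. -/
theorem mem_lang_iff {A : G.P → G.N} {w : G.P → List T} {B : G.P → Option G.N}
    (hl : ∀ p, G.lhs p = [A p])
    (hr : ∀ p, G.rhs p = (w p).map Sum.inr ++ (B p).toList.map Sum.inl)
    (σ : AccSigma) (ρ : AccRho) (π : DerivMode) (u : ℕ → T) :
    u ∈ G.Lang σ ρ π ↔ ∃ d, IsRun A w B G.start d u ∧ IsAccepting σ ρ G.acc d := by
  constructor
  · rintro ⟨s, d, h0, hstep, hub, hsp, hacc⟩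
    let o : ℕ → Option G.N := fun i => Nat.casesOn i (some G.start) fun j => B (d j)
    have hs : ∀ i, s i = (emitted w d i).map Sum.inr ++ (o i).toList.map Sum.inl := by
      intro i
      induction i with
      | zero => simpa [emitted, o] using h0
      | succ i ih =>
        have h := hstep i
        rw [ih, G.stepOf_iff π (hl _), hr] at h
        simpa [emitted, o] using h.2
    have ho : ∀ i, o i = some (A (d i)) := by
      intro i
      have h := hstep i
      rw [hs i, G.stepOf_iff π (hl _)] at h
      exact h.1
    have ht : ∀ i, termPrefix (s i) = emitted w d i := by
      intro i
      rw [hs i, termPrefix_map_append]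
    simp only [ht] at hub hsp
    exact ⟨d, ⟨(Option.some.inj (ho 0)).symm, fun i => ho (i + 1), hub, hsp⟩, hacc⟩
  · rintro ⟨d, ⟨h0, hn, hub, hsp⟩, hacc⟩
    refine ⟨fun i => (emitted w d i).map Sum.inr ++ (some (A (d i))).toList.map Sum.inl, d,
      by simp [emitted, h0], ?_, ?_, ?_, hacc⟩
    · intro i
      rw [G.stepOf_iff π (hl _), hr, hn i]
      simp [emitted]
    · simpa only [termPrefix_map_append] using hub
    · simpa only [termPrefix_map_append] using hsp

end OmegaPSG

section Stretch

variable {N P T : Type} {K : ℕ}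

theorem rhoRel_preimage {Q Q' : Type} {f : Q' → Q} (hf : Function.Surjective f)
    (ρ : AccRho) (X Y : Set Q) : rhoRel ρ (f ⁻¹' X) (f ⁻¹' Y) ↔ rhoRel ρ X Y := by
  cases ρ with
  | cap =>
    change (f ⁻¹' X ∩ f ⁻¹' Y).Nonempty ↔ (X ∩ Y).Nonempty
    rw [← Set.preimage_inter, hf.nonempty_preimage]
  | sub => exact hf.preimage_subset_preimage_iff
  | eq => exact hf.preimage_injective.eq_iff

theorem isAccepting_image_preimage {Q Q' : Type} {f : Q' → Q} (hf : Function.Surjective f)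
    {σ : AccSigma} {d : ℕ → Q} {d' : ℕ → Q'} (h : sigmaSet σ d' = f ⁻¹' sigmaSet σ d)
    (ρ : AccRho) (𝓕 : Set (Set Q)) :
    IsAccepting σ ρ (Set.preimage f '' 𝓕) d' ↔ IsAccepting σ ρ 𝓕 d := by
  simp [IsAccepting, h, rhoRel_preimage hf]

/-- Nonterminal on the right of the `j`-th copy of `p`: the one of `p` for the last copy,
otherwise the left-hand side of the next copy. -/
def copyTarget (B : P → Option N) (q : P × Fin K) : Option (N ⊕ (P × Fin K)) :=
  if h : q.2 + 1 < K then some (Sum.inr (q.1, ⟨q.2 + 1, h⟩)) else (B q.1).map Sum.inl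

theorem copyTarget_of_lt (B : P → Option N) (p : P) {k : ℕ} (hk : k + 1 < K) :
    copyTarget B (p, ⟨k, by lia⟩) = some (Sum.inr (p, (⟨k + 1, hk⟩ : Fin K))) := by
  simp [copyTarget, hk]

theorem copyTarget_last (B : P → Option N) (p : P) {j : Fin K} (hj : (j : ℕ) + 1 = K) :
    copyTarget B (p, j) = (B p).map Sum.inl := by
  simp [copyTarget, hj]

variable [NeZero K]

/-- Every production of `d` replaced by `K` successive copies of it, numbered from `0`. -/
def stretch (K : ℕ) [NeZero K] (d : ℕ → P) (i : ℕ) : P × Fin K := (d (i / K), Fin.ofNat K i)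

theorem stretch_mul_add (d : ℕ → P) (m : ℕ) (j : Fin K) :
    stretch K d (K * m + j) = (d m, j) := by
  have hK : 0 < K := NeZero.pos K
  refine Prod.ext ?_ (Fin.ext ?_)
  · simp [stretch, Nat.mul_add_div hK, Nat.div_eq_of_lt j.isLt]
  · simp [stretch, Nat.mod_eq_of_lt j.isLt]

theorem exists_eq_mul_add (i : ℕ) : ∃ (m : ℕ) (j : Fin K), i = K * m + j :=
  ⟨i / K, ⟨i % K, Nat.mod_lt _ (NeZero.pos K)⟩, (Nat.div_add_mod i K).symm⟩

theorem sigmaSet_stretch (σ : AccSigma) (d : ℕ → P) :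
    sigmaSet σ (stretch K d) = Prod.fst ⁻¹' sigmaSet σ d := by
  have hK : 0 < K := NeZero.pos K
  ext ⟨p, j⟩
  cases σ with
  | ran =>
    constructor
    · rintro ⟨i, hi⟩
      exact ⟨i / K, congrArg Prod.fst hi⟩
    · rintro ⟨m, rfl⟩
      exact ⟨K * m + j, stretch_mul_add d m j⟩
  | inf =>
    constructor
    · intro h n
      obtain ⟨m, hm, he⟩ := h (n * K)
      exact ⟨m / K, (Nat.le_div_iff_mul_le hK).2 hm, congrArg Prod.fst he⟩
    · intro h n
      obtain ⟨m, hm, rfl⟩ := h n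
      exact ⟨K * m + j, by nlinarith, stretch_mul_add d m j⟩

/-- The letter emitted by the `j`-th copy of a production with terminal part `w p`. -/
def letter (w : P → List T) (q : P × Fin K) : Option T := (w q.1)[(q.2 : ℕ)]?

theorem emitted_stretch {w : P → List T} (hw : ∀ p, (w p).length ≤ K) (d : ℕ → P) (m : ℕ) :
    emitted (fun q => (letter w q).toList) (stretch K d) (K * m) = emitted w d m := by
  induction m with
  | zero => rfl
  | succ m ih =>
    have key : ∀ k ≤ K, emitted (fun q => (letter w q).toList) (stretch K d) (K * m + k) =
        emitted w d m ++ (w (d m)).take k := by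
      intro k hk
      induction k with
      | zero => simpa using ih
      | succ k ihk =>
        rw [← add_assoc, emitted, ihk (by lia), List.append_assoc,
          stretch_mul_add d m ⟨k, hk⟩, List.take_add_one]
        rfl
    rw [Nat.mul_succ, key K le_rfl, List.take_of_length_le (hw _)]
    rfl

/-- Left-hand side of the `j`-th copy of `p`: the one of `p` if `j = 0`, otherwise an
intermediate nonterminal. -/
def copySource (A : P → N) (q : P × Fin K) : N ⊕ (P × Fin K) :=
  if q.2 = 0 then Sum.inl (A q.1) else Sum.inr q

theorem copySource_eq_inr {A : P → N} {q r : P × Fin K} (h : copySource A q = Sum.inr r) :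
    q = r := by
  unfold copySource at h
  split at h <;> simp_all

theorem copySource_eq_inl {A : P → N} {q : P × Fin K} {a : N}
    (h : copySource A q = Sum.inl a) : q.2 = 0 ∧ A q.1 = a := by
  unfold copySource at h
  split at h <;> simp_all

theorem isRun_stretch_iff {A : P → N} {w : P → List T} {B : P → Option N} {S : N}
    (hw : ∀ p, (w p).length ≤ K) {d : ℕ → P} {u : ℕ → T} :
    IsRun (copySource A) (fun q : P × Fin K => (letter w q).toList) (copyTarget B)
      (Sum.inl S) (stretch K d) u ↔ IsRun A w B S d u := by
  have hK : 0 < K := NeZero.pos K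
  have hzero : ∀ m, stretch K d (K * m) = (d m, 0) := fun m => by
    simpa using stretch_mul_add d m (0 : Fin K)
  have hle : ∀ i, i ≤ K * i := fun i => Nat.le_mul_of_pos_left i hK
  constructor
  · rintro ⟨h0, hn, hub, hsp⟩
    refine ⟨?_, fun m => ?_, fun n => ?_, fun m => ?_⟩
    · simpa [stretch] using (copySource_eq_inl h0).2
    · have h := hn (K * m + (K - 1))
      have e : K * m + (K - 1) + 1 = K * (m + 1) := by rw [Nat.mul_succ]; lia
      rw [e, hzero, stretch_mul_add d m ⟨K - 1, by lia⟩,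
        copyTarget_last _ _ (by simp only; lia)] at h
      simpa [copySource] using h
    · obtain ⟨i, hi⟩ := hub n
      refine ⟨i, ?_⟩
      rw [← emitted_stretch hw]
      exact hi.trans (emitted_prefix _ _ (hle i)).length_le
    · rw [← emitted_stretch hw]
      exact hsp _
  · rintro ⟨h0, hn, hub, hsp⟩
    refine ⟨?_, fun i => ?_, fun n => ?_, fun i => ?_⟩
    · have := hzero 0
      rw [Nat.mul_zero] at this
      simp [this, copySource, h0]
    · obtain ⟨m, ⟨k, hk⟩, rfl⟩ := exists_eq_mul_add (K := K) i
      rw [stretch_mul_add]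
      by_cases h : k + 1 < K
      · have := stretch_mul_add d m ⟨k + 1, h⟩
        simp only [← add_assoc] at this
        rw [copyTarget_of_lt _ _ h, this]
        simp [copySource, Fin.ext_iff]
      · have e : K * m + k + 1 = K * (m + 1) := by rw [Nat.mul_succ]; lia
        rw [e, hzero, copyTarget_last _ _ (by simp only; lia), hn m]
        simp [copySource]
    · obtain ⟨m, hm⟩ := hub n
      exact ⟨K * m, by rwa [emitted_stretch hw]⟩
    · have h := hsp i
      rw [← emitted_stretch hw] at h
      exact h.of_prefix (emitted_prefix _ _ (hle i))

/-- Every run of the copied productions is a stretched sequence. -/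
theorem exists_eq_stretch {A : P → N} {B : P → Option N} {S : N} {d' : ℕ → P × Fin K}
    (h0 : copySource A (d' 0) = Sum.inl S)
    (hn : ∀ i, copyTarget B (d' i) = some (copySource A (d' (i + 1)))) :
    ∃ d, d' = stretch K d := by
  have hK : 0 < K := NeZero.pos K
  have block : ∀ m, (d' (K * m)).2 = 0 →
      ∀ k (hk : k < K), d' (K * m + k) = ((d' (K * m)).1, ⟨k, hk⟩) := by
    intro m hm k hk
    induction k with
    | zero => exact Prod.ext rfl hm
    | succ k ih =>
      have h := hn (K * m + k)
      rw [ih (by lia), copyTarget_of_lt _ _ hk] at h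
      exact copySource_eq_inr (Option.some.inj h).symm
  have hzero : ∀ m, (d' (K * m)).2 = 0 := by
    intro m
    induction m with
    | zero => exact (copySource_eq_inl h0).1
    | succ m ih =>
      have h := hn (K * m + (K - 1))
      have e : K * m + (K - 1) + 1 = K * (m + 1) := by rw [Nat.mul_succ]; lia
      rw [e, block m ih (K - 1) (by lia), copyTarget_last _ _ (by simp only; lia)] at h
      obtain ⟨b, -, hb⟩ := Option.map_eq_some_iff.1 h
      exact (copySource_eq_inl hb.symm).1
  refine ⟨fun m => (d' (K * m)).1, funext fun i => ?_⟩
  obtain ⟨m, j, rfl⟩ := exists_eq_mul_add (K := K) i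
  rw [stretch_mul_add]
  exact block m (hzero m) j j.isLt

end Stretch

end OmegaFormal

/-- Lemma: every ω-RLG G has a (σ,ρ,π)-equivalent (for all modes) ω-RLG G'
whose productions are all of the form A → aB or A → a with a ∈ T ∪ {ε}. -/
theorem rlg_short_form (T : Type) [Fintype T] (G : OmegaPSG T) (hG : G.IsRLG) :
    ∃ G' : OmegaPSG T, G'.IsRLG ∧
      (∀ p : G'.P, (G'.lhs p).length = 1 ∧
        ∃ (a : Option T) (B : Option G'.N),
          G'.rhs p = a.toList.map Sum.inr ++ B.toList.map Sum.inl) ∧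
      ∀ (σ : AccSigma) (ρ : AccRho) (π : DerivMode),
        G.Lang σ ρ π = G'.Lang σ ρ π := by
  have := G.fintypeN
  have := G.fintypeP
  choose A hA using fun p => List.length_eq_one_iff.1 (hG p).1
  choose w B hr using fun p => (hG p).2
  obtain ⟨K, hK0, hw⟩ : ∃ K : ℕ, NeZero K ∧ ∀ p, (w p).length ≤ K :=
    ⟨Finset.univ.sup (fun p => (w p).length) + 1, inferInstance, fun p =>
      (Finset.le_sup (f := fun p => (w p).length) (Finset.mem_univ p)).trans (Nat.le_succ _)⟩
  let G' : OmegaPSG T :=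
    { N := G.N ⊕ (G.P × Fin K)
      P := G.P × Fin K
      lhs := fun q => [copySource A q]
      lhs_ne := fun _ => List.cons_ne_nil _ _
      rhs := fun q =>
        (letter w q).toList.map Sum.inr ++ (copyTarget B q).toList.map Sum.inl
      start := Sum.inl G.start
      acc := Set.preimage Prod.fst '' G.acc }
  refine ⟨G', fun q => ⟨rfl, _, _, rfl⟩, fun q => ⟨rfl, _, _, rfl⟩, fun σ ρ π => ?_⟩
  ext u
  rw [G.mem_lang_iff hA hr, G'.mem_lang_iff (A := copySource A)
    (w := fun q => (letter w q).toList) (B := copyTarget B) (fun _ => rfl) (fun _ => rfl)]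
  have hacc : ∀ d, IsAccepting σ ρ G'.acc (stretch K d) ↔ IsAccepting σ ρ G.acc d := fun d =>
    isAccepting_image_preimage Prod.fst_surjective (sigmaSet_stretch σ d) ρ G.acc
  constructor
  · rintro ⟨d, hd, h⟩
    exact ⟨stretch K d, (isRun_stretch_iff hw).2 hd, (hacc d).2 h⟩
  · rintro ⟨d', hd, h⟩
    obtain ⟨d, rfl⟩ := exists_eq_stretch hd.start hd.next
    exact ⟨d, (isRun_stretch_iff hw).1 hd, (hacc d).1 h⟩
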